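/- arXiv:2205.11369 — 2 statements merged into one kernel-verified Lean document; each statement's English description precedes it below -/
import Mathlib

section
/- Let κ = 1.296 and a = (κ−1)/κ = 37/162. For all real numbers x, y with 1 < x ≤ 2 and 1 < y ≤ 2, the relative error of the summed-power approximation satisfies ((x·y)^a − 1 − (x^a − 1) − (y^a − 1)) / ((x^a − 1) + (y^a − 1)) < 0.09. (This is the paper's claim that with at most two serial stages and all compression ratios smaller than 2.0, the approximation error is guaranteed to be smaller than 9%.) -/
/-- For `1 < x ≤ 2`, the power `x ^ (37 / 162)` lies strictly between `1` and `1.18`. -/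
theorem one_lt_rpow_and_rpow_lt {x : ℝ} (h1 : 1 < x) (h2 : x ≤ 2) :
    1 < x ^ (37 / 162 : ℝ) ∧ x ^ (37 / 162 : ℝ) < 1.18 := by
  refine ⟨Real.one_lt_rpow h1 (by norm_num), ?_⟩
  have hx : 0 ≤ x := by linarith
  refine lt_of_pow_lt_pow_left₀ 162 (by norm_num) ?_
  calc (x ^ (37 / 162 : ℝ)) ^ 162 = x ^ 37 := by
        rw [← Real.rpow_natCast, ← Real.rpow_mul hx, ← Real.rpow_natCast]
        norm_num
    _ ≤ 2 ^ 37 := by gcongr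
    _ < 1.18 ^ 162 := by norm_num

/-- With `κ = 1.296` and `a = (κ-1)/κ = 37/162`, for all `1 < x ≤ 2` and `1 < y ≤ 2`
the relative error of the summed-power approximation is smaller than 9%. -/
theorem serial_compression_relative_error_lt_nine_percent
    (κ a : ℝ) (hκ : κ = 1.296) (ha : a = (κ - 1) / κ)
    (ha' : a = 37 / 162)
    (x y : ℝ) (hx1 : 1 < x) (hx2 : x ≤ 2) (hy1 : 1 < y) (hy2 : y ≤ 2) :
    ((x * y) ^ a - 1 - (x ^ a - 1) - (y ^ a - 1)) / ((x ^ a - 1) + (y ^ a - 1)) < 0.09 := by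
  obtain ⟨hu1, hu2⟩ := one_lt_rpow_and_rpow_lt hx1 hx2
  obtain ⟨hv1, hv2⟩ := one_lt_rpow_and_rpow_lt hy1 hy2
  rw [← ha'] at hu1 hu2 hv1 hv2
  rw [Real.mul_rpow (by linarith) (by linarith), div_lt_iff₀ (by linarith)]
  norm_num at hu2 hv2 ⊢
  linarith [mul_pos (sub_pos.2 hu1) (sub_pos.2 hv2), mul_pos (sub_pos.2 hv1) (sub_pos.2 hu2)]
end

section
/- Fix a real exponent a > 0 and a real number y > 1. Then the function x ↦ (x^a − 1)(y^a − 1) / ((x^a − 1) + (y^a − 1)) is strictly increasing on (1, ∞). In particular, for 1 < x ≤ 2 and 1 < y ≤ 2 the relative error of the serial compression power approximation attains its supremum (2^a − 1)/2 at x = y = 2. -/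
/-- For a fixed exponent `a > 0` and fixed `y > 1`, the relative error
`x ↦ (x^a-1)(y^a-1)/((x^a-1)+(y^a-1))` is strictly increasing in `x` on `(1, ∞)`;
in particular for `1 < x ≤ 2`, `1 < y ≤ 2` it is at most `(2^a-1)/2`, and this value
is attained at `x = y = 2`. -/
theorem serial_compression_relative_error_monotone_and_sup (a : ℝ) (ha : 0 < a) :
    (∀ y : ℝ, 1 < y →
      StrictMonoOn
        (fun x : ℝ => (x ^ a - 1) * (y ^ a - 1) / ((x ^ a - 1) + (y ^ a - 1)))
        (Set.Ioi 1)) ∧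
    (∀ x y : ℝ, 1 < x → x ≤ 2 → 1 < y → y ≤ 2 →
      (x ^ a - 1) * (y ^ a - 1) / ((x ^ a - 1) + (y ^ a - 1)) ≤ ((2 : ℝ) ^ a - 1) / 2) ∧
    ((2 : ℝ) ^ a - 1) * ((2 : ℝ) ^ a - 1) / (((2 : ℝ) ^ a - 1) + ((2 : ℝ) ^ a - 1)) =
      ((2 : ℝ) ^ a - 1) / 2 := by
  have pos (x : ℝ) (hx : 1 < x) : 0 < x ^ a - 1 := sub_pos.2 (Real.one_lt_rpow hx ha)
  have le_two (x : ℝ) (hx : 1 < x) (hx2 : x ≤ 2) : x ^ a - 1 ≤ 2 ^ a - 1 :=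
    sub_le_sub_right (Real.rpow_le_rpow (by linarith) hx2 ha.le) 1
  refine ⟨fun y hy x hx z hz hxz => ?_, fun x y hx hx2 hy hy2 => ?_, ?_⟩
  · have hu := pos x hx
    have hv := pos y hy
    have hw := pos z hz
    have huw : x ^ a - 1 < z ^ a - 1 :=
      sub_lt_sub_right (Real.rpow_lt_rpow (zero_le_one.trans (le_of_lt hx)) hxz ha) 1
    dsimp only
    rw [div_lt_div_iff₀ (add_pos hu hv) (add_pos hw hv)]
    linarith [mul_lt_mul_of_pos_right huw (mul_pos hv hv)]
  · have hu := pos x hx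
    have hv := pos y hy
    rw [div_le_div_iff₀ (add_pos hu hv) two_pos]
    linarith [mul_le_mul_of_nonneg_right (le_two x hx hx2) hv.le,
      mul_le_mul_of_nonneg_right (le_two y hy hy2) hu.le]
  · have h := (pos 2 one_lt_two).ne'
    rw [← two_mul, mul_div_mul_right _ _ h]
end
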